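/- Assume X has a minimal subspace segmentation {X_1, …, X_K} with no pure segment such that no sample lies in S_k ∩ S_ℓ for k ≠ ℓ and {X_1, …, X_K} is intersected nondegenerately, and assume n_k > d_k + (K−1)d_0 for all k. A piece J_i is extendable if there exists a sample x_j ∈ span(X_{J_i}) with j ∉ J_i. If J = {J_1, …, J_K} ∈ J(K, d, d_min) and no piece J_i is extendable, then {J_1, …, J_K} = {J_1*, …, J_K*} (the partition equals the minimal partition). -/

import Mathlib

open Submodule Module Finset

noncomputable section

variable {m : ℕ} {ι : Type*}

/-- The subspace spanned by the subfamily of `x` indexed by `S`. -/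
def spanOf (x : ι → EuclideanSpace ℝ (Fin m)) (S : Finset ι) :
    Submodule ℝ (EuclideanSpace ℝ (Fin m)) :=
  Submodule.span ℝ (x '' (S : Set ι))

/-- The rank `r(X_S)` of the subfamily of `x` indexed by `S`. -/
def rOf (x : ι → EuclideanSpace ℝ (Fin m)) (S : Finset ι) : ℕ :=
  Module.finrank ℝ (spanOf x S)

/-- `X_S` is nondegenerate: every subfamily `X_T`, `T ⊆ S`, has rank `min |T| r(X_S)`. -/
def Nondeg (x : ι → EuclideanSpace ℝ (Fin m)) (S : Finset ι) : Prop :=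
  ∀ T ⊆ S, rOf x T = min T.card (rOf x S)

/-- `span(X_S)` is a minimal sample subspace: `n(X_S) > r(X_S)` and `X_S` is nondegenerate. -/
def IsMinimalSeg (x : ι → EuclideanSpace ℝ (Fin m)) (S : Finset ι) : Prop :=
  rOf x S < S.card ∧ Nondeg x S

/-- The component of `x i` in the orthogonal complement of `W ⊓ S'` within `W`. -/
def zComp (x : ι → EuclideanSpace ℝ (Fin m))
    (W S' : Submodule ℝ (EuclideanSpace ℝ (Fin m))) (i : ι) :
    EuclideanSpace ℝ (Fin m) :=
  (orthogonalProjection (W ⊓ (W ⊓ S')ᗮ) (x i) : EuclideanSpace ℝ (Fin m))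

/-- The segmentation `{X_1, …, X_K}` is intersected nondegenerately: for every `k` and every
subfamily indexed by `S` disjoint from `P k`, the family of components of the vectors of `X_k`
in the orthogonal complement (within `span(X_k)`) of `span(X_k) ⊓ span(X_S)` is zero or
nondegenerate. -/
def IntNondeg (x : ι → EuclideanSpace ℝ (Fin m)) {K : ℕ}
    (P : Fin K → Finset ι) : Prop :=
  ∀ (k : Fin K) (S : Finset ι), Disjoint S (P k) →
    (∀ i ∈ P k, zComp x (spanOf x (P k)) (spanOf x S) i = 0) ∨
      Nondeg (zComp x (spanOf x (P k)) (spanOf x S)) (P k)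

/-- A minimal subspace segmentation of `X` with no pure segment, with index pieces
`P 1, …, P K`. -/
structure IsMSSnp (x : ι → EuclideanSpace ℝ (Fin m)) {K : ℕ}
    (P : Fin K → Finset ι) : Prop where
  cover : ∀ i : ι, ∃ k, i ∈ P k
  disj : ∀ k ℓ, k ≠ ℓ → Disjoint (P k) (P ℓ)
  minimal : ∀ k, IsMinimalSeg x (P k)
  distinct : ∀ k ℓ, k ≠ ℓ → spanOf x (P k) ≠ spanOf x (P ℓ)

/-- The non-intersection condition for the minimal segments. -/
def NonIntersect (x : ι → EuclideanSpace ℝ (Fin m)) {K : ℕ}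
    (P : Fin K → Finset ι) : Prop :=
  ∀ (j : ι) (k ℓ : Fin K), k ≠ ℓ → x j ∉ spanOf x (P k) ⊓ spanOf x (P ℓ)

/-- The set `𝒥(K, d, dmin)`: partitions of the index set into `K` pieces, each of size
greater than `dmin`, whose segment ranks sum to at most `d`. -/
def InJSet (x : ι → EuclideanSpace ℝ (Fin m)) (K d dmin : ℕ)
    (Q : Fin K → Finset ι) : Prop :=
  (∀ i : ι, ∃ k, i ∈ Q k) ∧ (∀ k ℓ, k ≠ ℓ → Disjoint (Q k) (Q ℓ)) ∧
    (∀ k, dmin < (Q k).card) ∧ (∑ k, rOf x (Q k)) ≤ d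

theorem spanOf_mono (x : ι → EuclideanSpace ℝ (Fin m)) {S T : Finset ι} (h : S ⊆ T) :
    spanOf x S ≤ spanOf x T :=
  span_mono (Set.image_mono (by exact_mod_cast h))

theorem mem_spanOf (x : ι → EuclideanSpace ℝ (Fin m)) {S : Finset ι} {i : ι} (h : i ∈ S) :
    x i ∈ spanOf x S :=
  subset_span ⟨i, h, rfl⟩

theorem spanOf_le {x : ι → EuclideanSpace ℝ (Fin m)} {S : Finset ι}
    {V : Submodule ℝ (EuclideanSpace ℝ (Fin m))} (h : ∀ i ∈ S, x i ∈ V) : spanOf x S ≤ V := by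
  refine span_le.2 ?_
  rintro _ ⟨i, hi, rfl⟩
  exact h i hi

theorem spanOf_union [DecidableEq ι] (x : ι → EuclideanSpace ℝ (Fin m)) (S T : Finset ι) :
    spanOf x (S ∪ T) = spanOf x S ⊔ spanOf x T := by
  simp [spanOf, Set.image_union, span_union]

theorem zComp_mem (x : ι → EuclideanSpace ℝ (Fin m))
    (W V : Submodule ℝ (EuclideanSpace ℝ (Fin m))) (i : ι) : zComp x W V i ∈ W ⊓ (W ⊓ V)ᗮ :=
  SetLike.coe_mem _

theorem sub_zComp_mem {x : ι → EuclideanSpace ℝ (Fin m)}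
    {W V : Submodule ℝ (EuclideanSpace ℝ (Fin m))} {i : ι} (hi : x i ∈ W) :
    x i - zComp x W V i ∈ W ⊓ V := by
  have hz := zComp_mem x W V i
  have horth : x i - zComp x W V i ∈ (W ⊓ (W ⊓ V)ᗮ)ᗮ :=
    sub_starProjection_mem_orthogonal (K := W ⊓ (W ⊓ V)ᗮ) (x i)
  obtain ⟨a, ha, b, hb, hab⟩ :=
    (W ⊓ V).exists_add_mem_mem_orthogonal (x i - zComp x W V i)
  have hbW : b ∈ W := by
    have : b = (x i - zComp x W V i) - a := by rw [hab]; abel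
    rw [this]
    exact W.sub_mem (W.sub_mem hi hz.1) ha.1
  have hb0 : b = 0 := by
    have h1 : inner ℝ b (x i - zComp x W V i) = 0 := horth b ⟨hbW, hb⟩
    have h2 : inner ℝ b a = 0 := inner_left_of_mem_orthogonal ha hb
    rw [hab, inner_add_right, h2, zero_add] at h1
    exact inner_self_eq_zero.1 h1
  rw [hab, hb0, add_zero]
  exact ha

/-- A subfamily of a segment either completes the span of outside samples to a space containing
the whole segment, or it adds its full cardinality to the rank. -/
theorem IntNondeg.spanOf_le_or_card_add_le [DecidableEq ι] {x : ι → EuclideanSpace ℝ (Fin m)}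
    {K : ℕ} {P : Fin K → Finset ι} (hnd : IntNondeg x P) {k : Fin K} {A B : Finset ι}
    (hA : A ⊆ P k) (hB : Disjoint B (P k)) :
    spanOf x (P k) ≤ spanOf x (A ∪ B) ∨ A.card + rOf x B ≤ rOf x (A ∪ B) := by
  set W := spanOf x (P k)
  set z := zComp x W (spanOf x B) with hz
  have hsub : ∀ i ∈ P k, x i - z i ∈ spanOf x B := fun i hi =>
    (sub_zComp_mem (mem_spanOf x hi)).2
  have hBle : spanOf x B ≤ spanOf x (A ∪ B) := spanOf_mono x subset_union_right
  have hzA : spanOf z A ≤ spanOf x (A ∪ B) := spanOf_le fun i hi => by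
    have h1 := hBle (hsub i (hA hi))
    have h2 := mem_spanOf x (mem_union_left B hi)
    simpa using sub_mem h2 h1
  rcases hnd k B hB with h0 | hN
  · left
    refine spanOf_le fun i hi => hBle ?_
    have := hsub i hi
    rwa [hz, h0 i hi, sub_zero] at this
  · have hr := hN A hA
    rcases le_total A.card (rOf z (P k)) with hle | hle
    · right
      rw [min_eq_left hle] at hr
      have hinf : spanOf z A ⊓ spanOf x B = ⊥ := by
        rw [eq_bot_iff]
        rintro v ⟨hv, hvB⟩
        have hv' : v ∈ W ⊓ (W ⊓ spanOf x B)ᗮ :=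
          spanOf_le (fun i _ => zComp_mem x W (spanOf x B) i) hv
        have := hv'.2 v ⟨hv'.1, hvB⟩
        exact inner_self_eq_zero.1 this
      have hdim := Submodule.finrank_sup_add_finrank_inf_eq (spanOf z A) (spanOf x B)
      rw [hinf, finrank_bot, add_zero] at hdim
      calc A.card + rOf x B = finrank ℝ ↥(spanOf z A ⊔ spanOf x B) := by
            rw [hdim, ← hr]; rfl
        _ ≤ rOf x (A ∪ B) := Submodule.finrank_mono (sup_le hzA hBle)
    · left
      rw [min_eq_right hle] at hr
      have heq : spanOf z A = spanOf z (P k) :=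
        Submodule.eq_of_le_of_finrank_eq (spanOf_mono z hA) hr
      refine spanOf_le fun i hi => ?_
      have h1 : z i ∈ spanOf x (A ∪ B) := hzA (heq ▸ mem_spanOf z hi)
      simpa using add_mem (hBle (hsub i hi)) h1

/-- Lower bound for the rank of the part of a flat `F` covered by the segments in `s`. -/
theorem sum_le_rOf_biUnion_add [DecidableEq ι] {x : ι → EuclideanSpace ℝ (Fin m)}
    {K : ℕ} {P : Fin K → Finset ι} (hdisj : ∀ k ℓ, k ≠ ℓ → Disjoint (P k) (P ℓ))
    (hnd : IntNondeg x P) {d0 : ℕ}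
    (hd0 : ∀ k, finrank ℝ ↥(spanOf x (P k) ⊓ ⨆ (j) (_ : j ≠ k), spanOf x (P j)) ≤ d0)
    {F : Finset ι} (hF : ∀ j, x j ∈ spanOf x F → j ∈ F) (s : Finset (Fin K)) :
    ∑ k ∈ s, (if P k ⊆ F then rOf x (P k) else (F ∩ P k).card) ≤
      rOf x (s.biUnion fun k => F ∩ P k) + ∑ k ∈ s, (if P k ⊆ F then d0 else 0) := by
  induction s using Finset.induction_on with
  | empty => simp
  | insert k s hk ih =>
    rw [sum_insert hk, sum_insert hk, biUnion_insert]
    set B := s.biUnion fun k => F ∩ P k with hBdef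
    have hBk : Disjoint B (P k) := by
      rw [hBdef, disjoint_biUnion_left]
      intro j hj
      exact (hdisj j k (fun h => hk (h ▸ hj))).mono_left inter_subset_right
    have hBF : B ⊆ F := biUnion_subset.2 fun _ _ => inter_subset_left
    split_ifs with hc
    · have hBle : spanOf x B ≤ ⨆ (j) (_ : j ≠ k), spanOf x (P j) := by
        refine spanOf_le fun i hi => ?_
        obtain ⟨j, hj, hij⟩ := mem_biUnion.1 hi
        exact le_iSup₂_of_le (f := fun j (_ : j ≠ k) => spanOf x (P j)) j
          (fun h => hk (h ▸ hj)) le_rfl (mem_spanOf x (mem_inter.1 hij).2)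
      have h1 := Submodule.finrank_sup_add_finrank_inf_eq (spanOf x (P k)) (spanOf x B)
      have h2 : finrank ℝ ↥(spanOf x (P k) ⊓ spanOf x B) ≤ d0 :=
        (Submodule.finrank_mono (inf_le_inf_left _ hBle)).trans (hd0 k)
      rw [← spanOf_union] at h1
      rw [inter_eq_right.2 hc]
      unfold rOf at ih ⊢
      omega
    · rcases hnd.spanOf_le_or_card_add_le (inter_subset_right : F ∩ P k ⊆ P k) hBk with h | h
      · refine absurd (fun i hi => hF i ?_) hc
        exact spanOf_mono x (union_subset inter_subset_left hBF) (h (mem_spanOf x hi))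
      · omega

/-- If no piece of a partition in `𝒥(K, d, dmin)` is extendable, then the
partition is the minimal partition `{J_1*, …, J_K*}` (up to relabeling of the pieces). -/
theorem partition_eq_of_not_extendable [Fintype ι] [DecidableEq ι]
    (x : ι → EuclideanSpace ℝ (Fin m)) {K : ℕ} (P : Fin K → Finset ι)
    (hmss : IsMSSnp x P) (hni : NonIntersect x P) (hnd : IntNondeg x P)
    (d dmin d0 : ℕ)
    (hd : d = ∑ k, rOf x (P k))
    (hdmin : IsLeast (Set.range fun k => rOf x (P k)) dmin)
    (hd0 : IsGreatest (Set.range fun k =>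
      Module.finrank ℝ ↥(spanOf x (P k) ⊓ ⨆ (j) (_ : j ≠ k), spanOf x (P j))) d0)
    (h3 : ∀ k, rOf x (P k) + (K - 1) * d0 < (P k).card)
    (Q : Fin K → Finset ι) (hQ : InJSet x K d dmin Q)
    (hnotext : ∀ i : Fin K, ¬ ∃ j : ι, j ∉ Q i ∧ x j ∈ spanOf x (Q i)) :
    ∃ e : Fin K ≃ Fin K, ∀ k, Q (e k) = P k := by
  obtain ⟨hQcov, hQdisj, hQcard, hQsum⟩ := hQ
  have hPne : ∀ k, (P k).Nonempty := fun k => card_pos.1 (by have := h3 k; omega)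
  have huniq : ∀ {i j : Fin K} {a : ι}, a ∈ Q i → a ∈ Q j → i = j := fun {i j a} hi hj => by
    by_contra h
    exact disjoint_left.1 (hQdisj i j h) hi hj
  have hflat : ∀ i j, x j ∈ spanOf x (Q i) → j ∈ Q i := fun i j h => by
    by_contra hj
    exact hnotext i ⟨j, hj, h⟩
  have hrank : ∀ i, ∑ k, (if P k ⊆ Q i then rOf x (P k) else (Q i ∩ P k).card) ≤
      rOf x (Q i) + ∑ k, (if P k ⊆ Q i then d0 else 0) := fun i => by
    refine (sum_le_rOf_biUnion_add hmss.disj hnd (fun k => hd0.2 ⟨k, rfl⟩)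
      (hflat i) univ).trans (Nat.add_le_add_right ?_ _)
    exact Submodule.finrank_mono (spanOf_mono x (biUnion_subset.2 fun _ _ => inter_subset_left))
  have hcontained : ∀ k, ∃ i, P k ⊆ Q i := by
    by_contra! ⟨k₀, hk₀⟩
    set g : Fin K → ℕ := fun k => ∑ i, (if P k ⊆ Q i then rOf x (P k) else (Q i ∩ P k).card)
      with hg
    set c : Fin K → ℕ := fun k => ∑ i, (if P k ⊆ Q i then d0 else 0) with hc
    have htotal : ∑ k, g k ≤ ∑ i, rOf x (Q i) + ∑ k, c k := by
      rw [hg, hc, sum_comm, sum_comm (γ := Fin K) (f := fun k i => if P k ⊆ Q i then d0 else 0),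
        ← sum_add_distrib]
      exact sum_le_sum fun i _ => hrank i
    have hfree : ∀ k, (∀ i, ¬ P k ⊆ Q i) → c k = 0 ∧ g k = (P k).card := fun k hk => by
      refine ⟨by simp [hc, hk], ?_⟩
      simp only [hg, hk, if_false]
      rw [← card_biUnion fun i _ j _ hij =>
        (hQdisj i j hij).mono inter_subset_left inter_subset_left, ← biUnion_inter]
      congr 1
      refine inter_eq_right.2 fun a _ => ?_
      simpa using hQcov a
    have hstep : ∀ k, rOf x (P k) + c k ≤ g k + d0 := fun k => by
      by_cases hk : ∃ i, P k ⊆ Q i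
      · obtain ⟨i, hi⟩ := hk
        obtain ⟨a, ha⟩ := hPne k
        have hck : c k = d0 := by
          simp only [hc]
          rw [sum_eq_single i (fun j _ hj => if_neg fun h => hj (huniq (h ha) (hi ha)))
            (by simp), if_pos hi]
        have hgk : rOf x (P k) ≤ g k := by
          have := single_le_sum (s := univ)
            (f := fun i => if P k ⊆ Q i then rOf x (P k) else (Q i ∩ P k).card)
            (fun _ _ => Nat.zero_le _) (mem_univ i)
          simpa only [if_pos hi] using this
        omega
      · push Not at hk
        have := hfree k hk
        have := h3 k
        omega
    have herase : ∑ k ∈ univ.erase k₀, (rOf x (P k) + c k) ≤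
        ∑ k ∈ univ.erase k₀, (g k + d0) := sum_le_sum fun k _ => hstep k
    simp only [sum_add_distrib, sum_const, card_erase_of_mem (mem_univ k₀), card_univ,
      Fintype.card_fin, smul_eq_mul] at herase
    have e1 := add_sum_erase univ (fun k => rOf x (P k)) (mem_univ k₀)
    have e2 := add_sum_erase univ c (mem_univ k₀)
    have e3 := add_sum_erase univ g (mem_univ k₀)
    have := hfree k₀ hk₀
    have := h3 k₀
    omega
  choose f hf using hcontained
  have hsurj : Function.Surjective f := fun i => by
    obtain ⟨a, ha⟩ := card_pos.1 ((Nat.zero_le _).trans_lt (hQcard i))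
    obtain ⟨k, hk⟩ := hmss.cover a
    exact ⟨k, huniq (hf k hk) ha⟩
  have hinj : Function.Injective f := Finite.injective_iff_surjective.2 hsurj
  refine ⟨Equiv.ofBijective f ⟨hinj, hsurj⟩, fun k => (subset_antisymm (hf k) ?_).symm⟩
  intro a ha
  obtain ⟨l, hl⟩ := hmss.cover a
  rwa [← hinj (huniq (hf l hl) ha)]
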